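/- Uniqueness of the ground state density: let G be a finite, connected weighted graph, h > 0, 𝕍 ∈ ℝⁿ, and let 𝕎 ∈ ℝ^{n×n} be a symmetric positive semidefinite matrix. Then the energy functional ρ ↦ E(√ρ) = (h²/8)·I(ρ) + V(ρ) + W(ρ) is strictly convex on the open probability simplex P_o(G); in particular it has at most one critical point in P_o(G), and any minimizer of E(√ρ) over P_o(G) is unique. -/

import Mathlib

open Finset

/-- The discrete Fisher information. -/
noncomputable def fisherInfo {n : ℕ} (G : SimpleGraph (Fin n)) [DecidableRel G.Adj]
    (ω : Fin n → Fin n → ℝ) (ρ : Fin n → ℝ) : ℝ :=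
  (1 / 2) * ∑ j : Fin n, ∑ l : Fin n,
    (if G.Adj j l then
      ω j l * (Real.log (ρ j) - Real.log (ρ l)) ^ 2 * ((ρ j + ρ l) / 2) else 0)

/-- Linear potential energy `V(ρ) = Σ_j 𝕍_j ρ_j`. -/
noncomputable def potV {n : ℕ} (V : Fin n → ℝ) (ρ : Fin n → ℝ) : ℝ := ∑ j : Fin n, V j * ρ j

/-- Interaction potential energy `W(ρ) = (1/2)·Σ_{j,l} 𝕎_{jl} ρ_j ρ_l = (1/2) ρᵀ𝕎ρ`. -/
noncomputable def potW {n : ℕ} (W : Matrix (Fin n) (Fin n) ℝ) (ρ : Fin n → ℝ) : ℝ :=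
  (1 / 2) * ∑ j : Fin n, ∑ l : Fin n, W j l * ρ j * ρ l

/-- The partial derivative `∂f/∂ρ_j` of a function on `ℝⁿ`. -/
noncomputable def pderiv {n : ℕ} (f : (Fin n → ℝ) → ℝ) (ρ : Fin n → ℝ) (j : Fin n) : ℝ :=
  deriv (fun x : ℝ => f (Function.update ρ j x)) (ρ j)

/-- The edge density `(log x - log y)² (x + y) / 2` is the perspective of this function. -/
noncomputable def edgeProfile (t : ℝ) : ℝ := Real.log t ^ 2 * ((t + 1) / 2)

theorem strictConvexOn_edgeProfile : StrictConvexOn ℝ (Set.Ioi 0) edgeProfile := by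
  have h_deriv : ∀ t ∈ Set.Ioi (0 : ℝ), HasDerivAt edgeProfile
      (Real.log t * (1 + t⁻¹) + Real.log t ^ 2 / 2) t := by
    intro t ht
    have ht' : t ≠ 0 := ne_of_gt ht
    convert! ((Real.hasDerivAt_log ht').pow 2).mul
      (((hasDerivAt_id t).add_const 1).div_const 2) using 1
    simp only [id, Pi.pow_apply]
    field_simp
    ring
  have h_deriv2 : ∀ t ∈ Set.Ioi (0 : ℝ), HasDerivAt
      (fun t => Real.log t * (1 + t⁻¹) + Real.log t ^ 2 / 2)
      ((t + 1 + (t - 1) * Real.log t) / t ^ 2) t := by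
    intro t ht
    have ht' : t ≠ 0 := ne_of_gt ht
    convert! ((Real.hasDerivAt_log ht').mul ((hasDerivAt_inv ht').const_add 1)).add
      (((Real.hasDerivAt_log ht').pow 2).div_const 2) using 1
    field_simp
    ring
  refine strictConvexOn_of_deriv2_pos' (convex_Ioi 0)
    (fun t ht => (h_deriv t ht).continuousAt.continuousWithinAt) fun t ht => ?_
  have h_eq : deriv edgeProfile =ᶠ[nhds t]
      fun t => Real.log t * (1 + t⁻¹) + Real.log t ^ 2 / 2 := by
    filter_upwards [isOpen_Ioi.mem_nhds ht] with s hs using (h_deriv s hs).deriv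
  rw [Function.iterate_succ, Function.iterate_one, Function.comp_apply, h_eq.deriv_eq,
    (h_deriv2 t ht).deriv]
  have ht' : 0 < t := ht
  have h_nonneg : 0 ≤ (t - 1) * Real.log t := by
    rcases le_total 1 t with h1 | h1
    · exact mul_nonneg (by linarith) (Real.log_nonneg h1)
    · exact mul_nonneg_of_nonpos_of_nonpos (by linarith) (Real.log_nonpos ht'.le h1)
  positivity

theorem edgeDensity_eq_perspective {x y : ℝ} (hx : 0 < x) (hy : 0 < y) :
    (Real.log x - Real.log y) ^ 2 * ((x + y) / 2) = y * edgeProfile (x / y) := by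
  rw [edgeProfile, Real.log_div hx.ne' hy.ne']
  field_simp

theorem ratio_convex_comb {a b x₁ x₂ y₁ y₂ : ℝ} (hy₁ : y₁ ≠ 0) (hy₂ : y₂ ≠ 0) :
    (a * x₁ + b * x₂) / (a * y₁ + b * y₂) =
      (a * y₁ / (a * y₁ + b * y₂)) • (x₁ / y₁) + (b * y₂ / (a * y₁ + b * y₂)) • (x₂ / y₂) := by
  simp only [smul_eq_mul]
  field_simp

theorem edgeDensity_convex_lt {a b x₁ x₂ y₁ y₂ : ℝ} (ha : 0 < a) (hb : 0 < b)
    (hx₁ : 0 < x₁) (hx₂ : 0 < x₂) (hy₁ : 0 < y₁) (hy₂ : 0 < y₂) (hne : x₁ / y₁ ≠ x₂ / y₂) :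
    (Real.log (a * x₁ + b * x₂) - Real.log (a * y₁ + b * y₂)) ^ 2 *
        ((a * x₁ + b * x₂ + (a * y₁ + b * y₂)) / 2) <
      a * ((Real.log x₁ - Real.log y₁) ^ 2 * ((x₁ + y₁) / 2)) +
        b * ((Real.log x₂ - Real.log y₂) ^ 2 * ((x₂ + y₂) / 2)) := by
  have hY : 0 < a * y₁ + b * y₂ := by positivity
  rw [edgeDensity_eq_perspective (by positivity) hY, edgeDensity_eq_perspective hx₁ hy₁,
    edgeDensity_eq_perspective hx₂ hy₂, ratio_convex_comb hy₁.ne' hy₂.ne']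
  have h_lt := strictConvexOn_edgeProfile.2 (Set.mem_Ioi.2 (div_pos hx₁ hy₁))
    (Set.mem_Ioi.2 (div_pos hx₂ hy₂)) hne
    (show 0 < a * y₁ / (a * y₁ + b * y₂) by positivity)
    (show 0 < b * y₂ / (a * y₁ + b * y₂) by positivity) (by field_simp)
  refine (mul_lt_mul_of_pos_left h_lt hY).trans_eq ?_
  simp only [smul_eq_mul]
  field_simp

theorem edgeDensity_convex_le {a b x₁ x₂ y₁ y₂ : ℝ} (ha : 0 < a) (hb : 0 < b)
    (hx₁ : 0 < x₁) (hx₂ : 0 < x₂) (hy₁ : 0 < y₁) (hy₂ : 0 < y₂) :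
    (Real.log (a * x₁ + b * x₂) - Real.log (a * y₁ + b * y₂)) ^ 2 *
        ((a * x₁ + b * x₂ + (a * y₁ + b * y₂)) / 2) ≤
      a * ((Real.log x₁ - Real.log y₁) ^ 2 * ((x₁ + y₁) / 2)) +
        b * ((Real.log x₂ - Real.log y₂) ^ 2 * ((x₂ + y₂) / 2)) := by
  have hY : 0 < a * y₁ + b * y₂ := by positivity
  rw [edgeDensity_eq_perspective (by positivity) hY, edgeDensity_eq_perspective hx₁ hy₁,
    edgeDensity_eq_perspective hx₂ hy₂, ratio_convex_comb hy₁.ne' hy₂.ne']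
  have h_le := strictConvexOn_edgeProfile.convexOn.2 (Set.mem_Ioi.2 (div_pos hx₁ hy₁))
    (Set.mem_Ioi.2 (div_pos hx₂ hy₂))
    (show 0 ≤ a * y₁ / (a * y₁ + b * y₂) by positivity)
    (show 0 ≤ b * y₂ / (a * y₁ + b * y₂) by positivity) (by field_simp)
  refine (mul_le_mul_of_nonneg_left h_le hY.le).trans_eq ?_
  simp only [smul_eq_mul]
  field_simp

theorem convex_openSimplex {n : ℕ} :
    Convex ℝ {σ : Fin n → ℝ | (∀ j, 0 < σ j) ∧ ∑ j, σ j = 1} := by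
  intro x hx y hy a b ha hb hab
  refine ⟨fun j => convex_Ioi (0 : ℝ) (hx.1 j) (hy.1 j) ha hb hab, ?_⟩
  simp [sum_add_distrib, ← mul_sum, hx.2, hy.2, hab]

/-- Two densities with the same ratio along every edge of a connected graph coincide. -/
theorem eq_of_ratio_eq {n : ℕ} {G : SimpleGraph (Fin n)} (hconn : G.Connected)
    {x y : Fin n → ℝ} (hx : ∀ j, 0 < x j) (hy : ∀ j, 0 < y j) (hsum : ∑ j, x j = ∑ j, y j)
    (hratio : ∀ j l, G.Adj j l → x j / x l = y j / y l) : x = y := by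
  have h_walk : ∀ j l, x j * y l = y j * x l := by
    intro j l
    obtain ⟨p⟩ := hconn.preconnected j l
    induction p with
    | nil => exact mul_comm _ _
    | @cons u v w huv _ ih =>
      have h_edge := hratio u v huv
      rw [div_eq_div_iff (hx v).ne' (hy v).ne'] at h_edge
      refine mul_right_cancel₀ (mul_pos (hx v) (hy v)).ne' ?_
      linear_combination x v * y w * h_edge + y u * x v * ih
  funext j
  have h_sum : x j * ∑ l, y l = y j * ∑ l, x l := by
    simp only [mul_sum, h_walk j]
  have h_pos : 0 < ∑ l, y l := sum_pos (fun l _ => hy l) ⟨j, mem_univ j⟩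
  rw [hsum] at h_sum
  exact mul_right_cancel₀ h_pos.ne' h_sum

theorem strictConvexOn_fisherInfo {n : ℕ} {G : SimpleGraph (Fin n)} [DecidableRel G.Adj]
    (hconn : G.Connected) {ω : Fin n → Fin n → ℝ} (hωpos : ∀ j l, G.Adj j l → 0 < ω j l) :
    StrictConvexOn ℝ {σ : Fin n → ℝ | (∀ j, 0 < σ j) ∧ ∑ j, σ j = 1} (fisherInfo G ω) := by
  refine ⟨convex_openSimplex, fun x hx y hy hxy a b ha hb hab => ?_⟩
  obtain ⟨j₀, l₀, h_adj, h_ratio⟩ : ∃ j l, G.Adj j l ∧ x j / x l ≠ y j / y l := by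
    by_contra! h_all
    exact hxy (eq_of_ratio_eq hconn hx.1 hy.1 (hx.2.trans hy.2.symm) h_all)
  simp only [fisherInfo, smul_eq_mul, Pi.add_apply, Pi.smul_apply]
  rw [mul_left_comm a, mul_left_comm b, ← mul_add]
  refine mul_lt_mul_of_pos_left ?_ one_half_pos
  simp only [mul_sum, ← sum_add_distrib]
  have h_le : ∀ j l, (if G.Adj j l then ω j l *
        (Real.log (a * x j + b * y j) - Real.log (a * x l + b * y l)) ^ 2 *
        ((a * x j + b * y j + (a * x l + b * y l)) / 2) else 0) ≤
      a * (if G.Adj j l then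
        ω j l * (Real.log (x j) - Real.log (x l)) ^ 2 * ((x j + x l) / 2) else 0) +
      b * (if G.Adj j l then
        ω j l * (Real.log (y j) - Real.log (y l)) ^ 2 * ((y j + y l) / 2) else 0) := by
    intro j l
    split_ifs with hjl
    · have := mul_le_mul_of_nonneg_left
        (edgeDensity_convex_le ha hb (hx.1 j) (hy.1 j) (hx.1 l) (hy.1 l)) (hωpos j l hjl).le
      linarith
    · simp
  refine sum_lt_sum (fun j _ => sum_le_sum fun l _ => h_le j l)
    ⟨j₀, mem_univ _, sum_lt_sum (fun l _ => h_le j₀ l) ⟨l₀, mem_univ _, ?_⟩⟩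
  simp only [if_pos h_adj]
  have := mul_lt_mul_of_pos_left (edgeDensity_convex_lt ha hb (hx.1 j₀) (hy.1 j₀) (hx.1 l₀)
    (hy.1 l₀) h_ratio) (hωpos j₀ l₀ h_adj)
  linarith

theorem convexOn_potV {n : ℕ} (V : Fin n → ℝ) {s : Set (Fin n → ℝ)} (hs : Convex ℝ s) :
    ConvexOn ℝ s (potV V) := by
  refine ⟨hs, fun x _ y _ a b _ _ _ => le_of_eq ?_⟩
  simp only [potV, smul_eq_mul, mul_sum, ← sum_add_distrib, Pi.add_apply, Pi.smul_apply]
  exact sum_congr rfl fun j _ => by ring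

theorem potW_nonneg {n : ℕ} {W : Matrix (Fin n) (Fin n) ℝ} (hW : W.PosSemidef)
    (x : Fin n → ℝ) : 0 ≤ potW W x := by
  have h_nonneg := hW.dotProduct_mulVec_nonneg x
  refine mul_nonneg one_half_pos.le (h_nonneg.trans_eq ?_)
  simp only [dotProduct, Matrix.mulVec, mul_sum, star_trivial]
  exact sum_congr rfl fun j _ => sum_congr rfl fun l _ => by ring

theorem convexOn_potW {n : ℕ} {W : Matrix (Fin n) (Fin n) ℝ} (hW : W.PosSemidef)
    {s : Set (Fin n → ℝ)} (hs : Convex ℝ s) : ConvexOn ℝ s (potW W) := by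
  refine ⟨hs, fun x _ y _ a b ha hb hab => ?_⟩
  have h_gap : a * potW W x + b * potW W y - potW W (a • x + b • y) =
      a * b * potW W (x - y) := by
    obtain rfl : b = 1 - a := by linarith
    simp only [potW, mul_sum, ← sum_add_distrib, ← sum_sub_distrib, Pi.add_apply, Pi.smul_apply,
      Pi.sub_apply, smul_eq_mul]
    exact sum_congr rfl fun j _ => sum_congr rfl fun l _ => by ring
  have := mul_nonneg (mul_nonneg ha hb) (potW_nonneg hW (x - y))
  simp only [smul_eq_mul]
  linarith

theorem differentiableAt_fisherInfo {n : ℕ} (G : SimpleGraph (Fin n)) [DecidableRel G.Adj]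
    (ω : Fin n → Fin n → ℝ) {ρ : Fin n → ℝ} (hρ : ∀ j, 0 < ρ j) :
    DifferentiableAt ℝ (fisherInfo G ω) ρ := by
  refine DifferentiableAt.const_mul (DifferentiableAt.fun_sum fun j _ =>
    DifferentiableAt.fun_sum fun l _ => ?_) _
  have hj := (hρ j).ne'
  have hl := (hρ l).ne'
  split_ifs
  · fun_prop (disch := assumption)
  · fun_prop

theorem differentiable_potV {n : ℕ} (V : Fin n → ℝ) : Differentiable ℝ (potV V) := by
  unfold potV
  fun_prop

theorem differentiable_potW {n : ℕ} (W : Matrix (Fin n) (Fin n) ℝ) :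
    Differentiable ℝ (potW W) := by
  unfold potW
  fun_prop

theorem pderiv_eq_fderiv {n : ℕ} {f : (Fin n → ℝ) → ℝ} {ρ : Fin n → ℝ}
    (hf : DifferentiableAt ℝ f ρ) (j : Fin n) :
    pderiv f ρ j = fderiv ℝ f ρ (Pi.single j 1) := by
  have h_f : HasFDerivAt f (fderiv ℝ f ρ) (Function.update ρ j (ρ j)) := by
    rw [Function.update_eq_self]
    exact hf.hasFDerivAt
  exact (h_f.comp_hasDerivAt (ρ j) (hasDerivAt_update ρ j (ρ j))).deriv

/-- If all partial derivatives at `ρ` agree, the derivative vanishes on zero-sum directions. -/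
theorem fderiv_eq_zero_of_pderiv_const {n : ℕ} {f : (Fin n → ℝ) → ℝ} {ρ : Fin n → ℝ}
    (hf : DifferentiableAt ℝ f ρ) {ν : ℝ} (hν : ∀ j, pderiv f ρ j = ν)
    {v : Fin n → ℝ} (hv : ∑ j, v j = 0) : fderiv ℝ f ρ v = 0 := by
  conv_lhs => rw [pi_eq_sum_univ' v]
  simp only [map_sum, map_smul, smul_eq_mul]
  have h_single : ∀ j, fderiv ℝ f ρ (Pi.single j 1) = ν :=
    fun j => (pderiv_eq_fderiv hf j).symm.trans (hν j)
  simp only [h_single, ← sum_mul, hv, zero_mul]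

/-- A critical point of a convex function, relative to a convex set, is a minimizer. -/
theorem ConvexOn.le_of_fderiv_sub_eq_zero {E : Type*} [NormedAddCommGroup E] [NormedSpace ℝ E]
    {s : Set E} {f : E → ℝ} (hf : ConvexOn ℝ s f) {x y : E} (hx : x ∈ s) (hy : y ∈ s)
    (hdiff : DifferentiableAt ℝ f x) (hzero : fderiv ℝ f x (y - x) = 0) : f x ≤ f y := by
  have h_line : ConvexOn ℝ (AffineMap.lineMap x y ⁻¹' s) (f ∘ AffineMap.lineMap (k := ℝ) x y) :=
    hf.comp_affineMap _
  have h_deriv : HasDerivAt (f ∘ AffineMap.lineMap (k := ℝ) x y) 0 0 := by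
    have h_f : HasFDerivAt f (fderiv ℝ f x) (AffineMap.lineMap x y (0 : ℝ)) := by
      rw [AffineMap.lineMap_apply_zero]
      exact hdiff.hasFDerivAt
    simpa only [hzero] using h_f.comp_hasDerivAt (0 : ℝ) AffineMap.hasDerivAt_lineMap
  have h_slope := h_line.le_slope_of_hasDerivAt (x := 0) (y := 1) (by simpa using hx)
    (by simpa using hy) one_pos h_deriv
  simpa [slope_def_field] using h_slope

/-- uniqueness of the ground state density: if `𝕎` is symmetric positive
semidefinite then `E(√ρ) = (h²/8)I(ρ) + V(ρ) + W(ρ)` is strictly convex on the open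
probability simplex; in particular it has at most one critical point (in the Lagrange
sense) there, and any minimizer over the open simplex is unique. -/
theorem ground_state_unique {n : ℕ}
    (G : SimpleGraph (Fin n)) [DecidableRel G.Adj] (hconn : G.Connected)
    (ω : Fin n → Fin n → ℝ) (hω : ∀ j l, ω j l = ω l j)
    (hωpos : ∀ j l, G.Adj j l → 0 < ω j l)
    (h : ℝ) (hh : 0 < h) (V : Fin n → ℝ)
    (W : Matrix (Fin n) (Fin n) ℝ) (hW : W.PosSemidef) :
    StrictConvexOn ℝ {σ : Fin n → ℝ | (∀ j, 0 < σ j) ∧ ∑ j, σ j = 1}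
      (fun σ => (h ^ 2 / 8) * fisherInfo G ω σ + potV V σ + potW W σ) ∧
    (∀ ρ₁ ρ₂ : Fin n → ℝ,
      ρ₁ ∈ {σ : Fin n → ℝ | (∀ j, 0 < σ j) ∧ ∑ j, σ j = 1} →
      ρ₂ ∈ {σ : Fin n → ℝ | (∀ j, 0 < σ j) ∧ ∑ j, σ j = 1} →
      (∃ ν₁ : ℝ, ∀ j, pderiv
          (fun σ => (h ^ 2 / 8) * fisherInfo G ω σ + potV V σ + potW W σ) ρ₁ j = ν₁) →
      (∃ ν₂ : ℝ, ∀ j, pderiv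
          (fun σ => (h ^ 2 / 8) * fisherInfo G ω σ + potV V σ + potW W σ) ρ₂ j = ν₂) →
      ρ₁ = ρ₂) ∧
    (∀ ρ₁ ρ₂ : Fin n → ℝ,
      ρ₁ ∈ {σ : Fin n → ℝ | (∀ j, 0 < σ j) ∧ ∑ j, σ j = 1} →
      ρ₂ ∈ {σ : Fin n → ℝ | (∀ j, 0 < σ j) ∧ ∑ j, σ j = 1} →
      (∀ σ ∈ {σ : Fin n → ℝ | (∀ j, 0 < σ j) ∧ ∑ j, σ j = 1},
        (h ^ 2 / 8) * fisherInfo G ω ρ₁ + potV V ρ₁ + potW W ρ₁ ≤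
          (h ^ 2 / 8) * fisherInfo G ω σ + potV V σ + potW W σ) →
      (∀ σ ∈ {σ : Fin n → ℝ | (∀ j, 0 < σ j) ∧ ∑ j, σ j = 1},
        (h ^ 2 / 8) * fisherInfo G ω ρ₂ + potV V ρ₂ + potW W ρ₂ ≤
          (h ^ 2 / 8) * fisherInfo G ω σ + potV V σ + potW W σ) →
      ρ₁ = ρ₂) := by
  set S := {σ : Fin n → ℝ | (∀ j, 0 < σ j) ∧ ∑ j, σ j = 1}
  have h_convex : StrictConvexOn ℝ S
      (fun σ => (h ^ 2 / 8) * fisherInfo G ω σ + potV V σ + potW W σ) := by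
    have hc : 0 < h ^ 2 / 8 := by positivity
    refine (StrictConvexOn.add_convexOn ?_ (convexOn_potV V convex_openSimplex)).add_convexOn
      (convexOn_potW hW convex_openSimplex)
    refine ⟨convex_openSimplex, fun x hx y hy hxy a b ha hb hab => ?_⟩
    have := mul_lt_mul_of_pos_left
      ((strictConvexOn_fisherInfo hconn hωpos).2 hx hy hxy ha hb hab) hc
    simp only [smul_eq_mul] at this ⊢
    linarith
  have h_min : ∀ ρ₁ ∈ S, ∀ ρ₂ ∈ S,
      (∀ σ ∈ S, (h ^ 2 / 8) * fisherInfo G ω ρ₁ + potV V ρ₁ + potW W ρ₁ ≤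
          (h ^ 2 / 8) * fisherInfo G ω σ + potV V σ + potW W σ) →
      (∀ σ ∈ S, (h ^ 2 / 8) * fisherInfo G ω ρ₂ + potV V ρ₂ + potW W ρ₂ ≤
          (h ^ 2 / 8) * fisherInfo G ω σ + potV V σ + potW W σ) → ρ₁ = ρ₂ :=
    fun ρ₁ h₁ ρ₂ h₂ hmin₁ hmin₂ => h_convex.eq_of_isMinOn hmin₁ hmin₂ h₁ h₂
  have h_crit : ∀ ρ ∈ S, (∃ ν : ℝ, ∀ j, pderiv
        (fun σ => (h ^ 2 / 8) * fisherInfo G ω σ + potV V σ + potW W σ) ρ j = ν) →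
      ∀ σ ∈ S, (h ^ 2 / 8) * fisherInfo G ω ρ + potV V ρ + potW W ρ ≤
        (h ^ 2 / 8) * fisherInfo G ω σ + potV V σ + potW W σ := by
    rintro ρ hρ ⟨ν, hν⟩ σ hσ
    have h_diff : DifferentiableAt ℝ
        (fun σ => (h ^ 2 / 8) * fisherInfo G ω σ + potV V σ + potW W σ) ρ :=
      (((differentiableAt_fisherInfo G ω hρ.1).const_mul _).add
        (differentiable_potV V ρ)).add (differentiable_potW W ρ)
    exact h_convex.convexOn.le_of_fderiv_sub_eq_zero hρ hσ h_diff
      (fderiv_eq_zero_of_pderiv_const h_diff hν (by simp [hρ.2, hσ.2]))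
  exact ⟨h_convex, fun ρ₁ ρ₂ h₁ h₂ hc₁ hc₂ =>
    h_min ρ₁ h₁ ρ₂ h₂ (h_crit ρ₁ h₁ hc₁) (h_crit ρ₂ h₂ hc₂),
    fun ρ₁ ρ₂ h₁ h₂ => h_min ρ₁ h₁ ρ₂ h₂⟩
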